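/- Let x̄ ∈ ℝ^n satisfy Min(F(x̄), K) = WMin(F(x̄), K) and let Ω > 0. Then x̄ is not a K-critical point for F if and only if θ(x̄) < 0; moreover, if x̄ is not K-critical, then every s attaining the minimum in the definition of θ(x̄) is nonzero. -/

import Mathlib

open Set Metric Pointwise

noncomputable section

/-- Oriented distance function `Δ_A(y) = d(y, A) − d(y, Aᶜ)`. -/
def orientedDist {E : Type*} [NormedAddCommGroup E] (A : Set E) (y : E) : ℝ :=
  Metric.infDist y A - Metric.infDist y Aᶜ

/-- The vector `sᵀ∇²f(x)s` of second-order directional derivatives. -/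
def quadForm {E F : Type*} [NormedAddCommGroup E] [NormedSpace ℝ E]
    [NormedAddCommGroup F] [NormedSpace ℝ F] (f : E → F) (x s : E) : F :=
  fderiv ℝ (fun y => fderiv ℝ f y s) x s

/-- Quadratic model `m(s) = ∇f(x)ᵀs + ½ sᵀ∇²f(x)s`. -/
def modelFn {E F : Type*} [NormedAddCommGroup E] [NormedSpace ℝ E]
    [NormedAddCommGroup F] [NormedSpace ℝ F] (f : E → F) (x s : E) : F :=
  fderiv ℝ f x s + (2⁻¹ : ℝ) • quadForm f x s

variable {n m p : ℕ}

/-- The set of `K`-minimal elements of `A`: `{y ∈ A : (y − K) ∩ A = {y}}`. -/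
def MinSet (K A : Set (EuclideanSpace ℝ (Fin m))) : Set (EuclideanSpace ℝ (Fin m)) :=
  {y | y ∈ A ∧ {z | y - z ∈ K} ∩ A = {y}}

/-- The set of weakly `K`-minimal elements of `A`: `{y ∈ A : (y − int K) ∩ A = ∅}`. -/
def WMinSet (K A : Set (EuclideanSpace ℝ (Fin m))) : Set (EuclideanSpace ℝ (Fin m)) :=
  {y | y ∈ A ∧ {z | y - z ∈ interior K} ∩ A = ∅}

/-- The set-valued objective `F(x) = {f¹(x), …, fᵖ(x)}`. -/
def Fval (f : Fin p → EuclideanSpace ℝ (Fin n) → EuclideanSpace ℝ (Fin m))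
    (x : EuclideanSpace ℝ (Fin n)) : Set (EuclideanSpace ℝ (Fin m)) :=
  Set.range fun i => f i x

/-- `a` is an element of the partition set `P_xb`: to each `v ∈ WMin(F(xb), K)` it
assigns an index `a v` with `f^{a v}(xb) = v` and `v ∈ Min(F(xb), K)`. -/
def IsSelection (K : Set (EuclideanSpace ℝ (Fin m)))
    (f : Fin p → EuclideanSpace ℝ (Fin n) → EuclideanSpace ℝ (Fin m))
    (xb : EuclideanSpace ℝ (Fin n)) (a : EuclideanSpace ℝ (Fin m) → Fin p) : Prop :=
  ∀ v ∈ WMinSet K (Fval f xb), f (a v) xb = v ∧ v ∈ MinSet K (Fval f xb)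

/-- `xb` is a `K`-critical point for `F`. -/
def KCritical (K : Set (EuclideanSpace ℝ (Fin m)))
    (f : Fin p → EuclideanSpace ℝ (Fin n) → EuclideanSpace ℝ (Fin m))
    (xb : EuclideanSpace ℝ (Fin n)) : Prop :=
  ¬ ∃ (a : EuclideanSpace ℝ (Fin m) → Fin p) (s : EuclideanSpace ℝ (Fin n)),
      IsSelection K f xb a ∧
      ∀ v ∈ WMinSet K (Fval f xb), fderiv ℝ (f (a v)) xb s ∈ -interior K

/-- Strict lower set less relation: `A ≺ˡ_K B ⟺ B ⊆ A + int K`. -/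
def StrictLowerLess (K A B : Set (EuclideanSpace ℝ (Fin m))) : Prop :=
  B ⊆ A + interior K

/-- The value `Θ_xb(a, s)`: max over `v ∈ WMin(F(xb), K)` of
`max{Δ_{−K}(∇f^{a v}(xb)ᵀs + ½ sᵀ∇²f^{a v}(xb)s), Δ_{−K}(∇f^{a v}(xb)ᵀs)}`. -/
def Theta (K : Set (EuclideanSpace ℝ (Fin m)))
    (f : Fin p → EuclideanSpace ℝ (Fin n) → EuclideanSpace ℝ (Fin m))
    (xb : EuclideanSpace ℝ (Fin n)) (a : EuclideanSpace ℝ (Fin m) → Fin p)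
    (s : EuclideanSpace ℝ (Fin n)) : ℝ :=
  sSup {r : ℝ | ∃ v ∈ WMinSet K (Fval f xb), r =
      max (orientedDist (-K) (modelFn (f (a v)) xb s))
          (orientedDist (-K) (fderiv ℝ (f (a v)) xb s))}

/-- `(a, s)` attains the minimum defining `θ(xb)` over `P_xb × {s : ‖s‖ ≤ Ω}`. -/
def AttainsMin (K : Set (EuclideanSpace ℝ (Fin m)))
    (f : Fin p → EuclideanSpace ℝ (Fin n) → EuclideanSpace ℝ (Fin m))
    (xb : EuclideanSpace ℝ (Fin n)) (Ω : ℝ)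
    (a : EuclideanSpace ℝ (Fin m) → Fin p) (s : EuclideanSpace ℝ (Fin n)) : Prop :=
  IsSelection K f xb a ∧ ‖s‖ ≤ Ω ∧
    ∀ (a' : EuclideanSpace ℝ (Fin m) → Fin p) (s' : EuclideanSpace ℝ (Fin n)),
      IsSelection K f xb a' → ‖s'‖ ≤ Ω → Theta K f xb a s ≤ Theta K f xb a' s'

theorem orientedDist_neg_iff {E : Type*} [NormedAddCommGroup E] {A : Set E}
    (hA : A ≠ univ) (y : E) : orientedDist A y < 0 ↔ y ∈ interior A := by
  have hne : (Aᶜ).Nonempty := nonempty_compl.2 hA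
  have key : y ∈ interior A ↔ 0 < infDist y Aᶜ := by
    rw [interior_eq_compl_closure_compl, mem_compl_iff, mem_closure_iff_infDist_zero hne]
    exact ⟨fun h => lt_of_le_of_ne infDist_nonneg (Ne.symm h), fun h => h.ne'⟩
  constructor
  · intro h
    rw [key]
    have h0 : 0 ≤ infDist y A := infDist_nonneg
    unfold orientedDist at h
    linarith
  · intro h
    have h0 : infDist y A = 0 := infDist_zero_of_mem (interior_subset h)
    unfold orientedDist
    linarith [key.1 h]

theorem quadForm_smul {E F : Type*} [NormedAddCommGroup E] [NormedSpace ℝ E]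
    [NormedAddCommGroup F] [NormedSpace ℝ F] (f : E → F) (x s : E) (t : ℝ) :
    quadForm f x (t • s) = t • t • quadForm f x s := by
  have h : (fun y => fderiv ℝ f y (t • s)) = t • fun y => fderiv ℝ f y s := by
    ext y
    simp
  rw [quadForm, h, fderiv_const_smul_field]
  simp [quadForm]

theorem modelFn_smul {E F : Type*} [NormedAddCommGroup E] [NormedSpace ℝ E]
    [NormedAddCommGroup F] [NormedSpace ℝ F] (f : E → F) (x s : E) (t : ℝ) :
    modelFn f x (t • s) = t • (fderiv ℝ f x s + t • (2⁻¹ : ℝ) • quadForm f x s) := by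
  rw [modelFn, quadForm_smul, map_smul, smul_add]
  congr 1
  simp only [smul_smul]
  congr 1
  ring

theorem smul_mem_interior_of_cone {E : Type*} [NormedAddCommGroup E] [NormedSpace ℝ E]
    {K : Set E} (hK : ∀ t : ℝ, 0 ≤ t → ∀ y ∈ K, t • y ∈ K) {t : ℝ} (ht : 0 < t) {y : E}
    (hy : y ∈ interior K) : t • y ∈ interior K := by
  have hsub : t • interior K ⊆ interior K := by
    refine interior_maximal ?_ (isOpen_interior.smul₀ ht.ne')
    rintro _ ⟨z, hz, rfl⟩
    exact hK t ht.le z (interior_subset hz)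
  exact hsub (smul_mem_smul_set hy)

/-- Along a first-order descent direction, the quadratic model eventually descends as well. -/
theorem eventually_modelFn_smul_mem {E F : Type*} [NormedAddCommGroup E] [NormedSpace ℝ E]
    [NormedAddCommGroup F] [NormedSpace ℝ F] {K : Set F}
    (hK : ∀ t : ℝ, 0 ≤ t → ∀ y ∈ K, t • y ∈ K) (f : E → F) (x s : E)
    (h : fderiv ℝ f x s ∈ interior K) :
    ∀ᶠ t : ℝ in nhdsWithin 0 (Ioi 0), modelFn f x (t • s) ∈ interior K := by
  have hcont : Continuous fun t : ℝ =>
      fderiv ℝ f x s + t • (2⁻¹ : ℝ) • quadForm f x s := by fun_prop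
  have hev : ∀ᶠ t : ℝ in nhds 0,
      fderiv ℝ f x s + t • (2⁻¹ : ℝ) • quadForm f x s ∈ interior K :=
    hcont.continuousAt.eventually_mem (isOpen_interior.mem_nhds (by simpa using h))
  filter_upwards [nhdsWithin_le_nhds hev, self_mem_nhdsWithin] with t ht ht0
  rw [modelFn_smul]
  exact smul_mem_interior_of_cone hK ht0 ht

theorem minSet_nonempty {m : ℕ} {K A : Set (EuclideanSpace ℝ (Fin m))}
    (hKconvex : Convex ℝ K) (hKcone : ∀ t : ℝ, 0 ≤ t → ∀ y ∈ K, t • y ∈ K)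
    (hKpointed : K ∩ -K = {0}) (hA : A.Finite) (hne : A.Nonempty) :
    (MinSet K A).Nonempty := by
  have h0 : (0 : EuclideanSpace ℝ (Fin m)) ∈ K := by
    have : (0 : EuclideanSpace ℝ (Fin m)) ∈ K ∩ -K := by rw [hKpointed]; rfl
    exact this.1
  have hadd : ∀ y ∈ K, ∀ z ∈ K, y + z ∈ K := fun y hy z hz => by
    have h := hKcone 2 (by norm_num) _ (hKconvex hy hz (a := 2⁻¹) (b := 2⁻¹) (by norm_num)
      (by norm_num) (by norm_num))
    simpa [smul_smul] using h
  let order : PartialOrder (EuclideanSpace ℝ (Fin m)) :=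
    { le := fun z y => y - z ∈ K
      le_refl := fun y => by simpa using h0
      le_trans := fun x y z hxy hyz => by simpa using hadd _ hyz _ hxy
      le_antisymm := fun x y hxy hyx => by
        have h : y - x ∈ K ∩ -K := ⟨hxy, by simpa using hyx⟩
        rw [hKpointed] at h
        exact (sub_eq_zero.1 h).symm }
  obtain ⟨y, hy⟩ := hA.exists_minimal hne
  refine ⟨y, hy.prop, Subset.antisymm ?_ ?_⟩
  · rintro z ⟨hz, hzA⟩
    exact hy.eq_of_le hzA hz
  · rintro _ rfl
    exact ⟨by simpa using h0, hy.prop⟩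

theorem theta_neg_iff {n m p : ℕ} {K : Set (EuclideanSpace ℝ (Fin m))}
    {f : Fin p → EuclideanSpace ℝ (Fin n) → EuclideanSpace ℝ (Fin m)}
    {xb : EuclideanSpace ℝ (Fin n)} (hne : (WMinSet K (Fval f xb)).Nonempty)
    (hK : -K ≠ univ) (a : EuclideanSpace ℝ (Fin m) → Fin p) (s : EuclideanSpace ℝ (Fin n)) :
    Theta K f xb a s < 0 ↔ ∀ v ∈ WMinSet K (Fval f xb),
      modelFn (f (a v)) xb s ∈ interior (-K) ∧ fderiv ℝ (f (a v)) xb s ∈ interior (-K) := by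
  set S : Set ℝ := {r : ℝ | ∃ v ∈ WMinSet K (Fval f xb), r =
      max (orientedDist (-K) (modelFn (f (a v)) xb s))
          (orientedDist (-K) (fderiv ℝ (f (a v)) xb s))}
  have hWfin : (WMinSet K (Fval f xb)).Finite := (finite_range _).subset fun v hv => hv.1
  have hSfin : S.Finite := by
    refine (hWfin.image fun v => max (orientedDist (-K) (modelFn (f (a v)) xb s))
      (orientedDist (-K) (fderiv ℝ (f (a v)) xb s))).subset ?_
    rintro r ⟨v, hv, rfl⟩
    exact ⟨v, hv, rfl⟩
  have hSne : S.Nonempty := let ⟨v, hv⟩ := hne; ⟨_, v, hv, rfl⟩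
  change sSup S < 0 ↔ _
  rw [hSfin.csSup_lt_iff hSne]
  constructor
  · intro h v hv
    have := h _ ⟨v, hv, rfl⟩
    rwa [max_lt_iff, orientedDist_neg_iff hK, orientedDist_neg_iff hK] at this
  · rintro h _ ⟨v, hv, rfl⟩
    rw [max_lt_iff, orientedDist_neg_iff hK, orientedDist_neg_iff hK]
    exact h v hv

/-- `xb` is not `K`-critical iff `θ(xb) < 0`; moreover, if `xb` is
not `K`-critical then every `s` attaining the minimum defining `θ(xb)` is nonzero
(Theorem `critopti` (b)). -/
theorem not_kCritical_iff_theta_neg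
    {n m p : ℕ} (K : Set (EuclideanSpace ℝ (Fin m)))
    (hKne : K.Nonempty) (hKclosed : IsClosed K) (hKconvex : Convex ℝ K)
    (hKcone : ∀ t : ℝ, 0 ≤ t → ∀ y ∈ K, t • y ∈ K)
    (hKpointed : K ∩ -K = {0})
    (hKsolid : (interior K).Nonempty)
    (f : Fin p → EuclideanSpace ℝ (Fin n) → EuclideanSpace ℝ (Fin m))
    (hf : ∀ i, ContDiff ℝ 2 (f i))
    (xb : EuclideanSpace ℝ (Fin n))
    (hMW : MinSet K (Fval f xb) = WMinSet K (Fval f xb))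
    (Ω : ℝ) (hΩ : 0 < Ω)
    (a₀ : EuclideanSpace ℝ (Fin m) → Fin p) (s₀ : EuclideanSpace ℝ (Fin n))
    (hmin : AttainsMin K f xb Ω a₀ s₀) :
    (¬ KCritical K f xb ↔ Theta K f xb a₀ s₀ < 0) ∧
    (¬ KCritical K f xb →
      ∀ (a : EuclideanSpace ℝ (Fin m) → Fin p) (s : EuclideanSpace ℝ (Fin n)),
        AttainsMin K f xb Ω a s → s ≠ 0) := by
  have hWne : (WMinSet K (Fval f xb)).Nonempty := hMW ▸
    minSet_nonempty hKconvex hKcone hKpointed (finite_range _) ⟨_, a₀ 0, rfl⟩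
  have hWfin : (WMinSet K (Fval f xb)).Finite := (finite_range _).subset fun v hv => hv.1
  have hint : interior (-K) = -interior K := ((Homeomorph.neg _).preimage_interior K).symm
  have h0 : (0 : EuclideanSpace ℝ (Fin m)) ∉ interior K := by
    obtain ⟨v, hvA, hv⟩ := hWne
    intro h
    have : v ∈ {z | v - z ∈ interior K} ∩ Fval f xb := ⟨by simpa using h, hvA⟩
    rw [hv] at this
    exact this
  have hK : -K ≠ univ := fun h => h0 <| by
    have : (0 : EuclideanSpace ℝ (Fin m)) ∈ interior (-K) := by simp [h]
    rw [hint] at this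
    simpa using this
  have hnegcone : ∀ t : ℝ, 0 ≤ t → ∀ y ∈ -K, t • y ∈ -K := fun t ht y hy => by
    simpa using hKcone t ht (-y) hy
  have descent : ¬ KCritical K f xb → ∀ a s, AttainsMin K f xb Ω a s →
      Theta K f xb a s < 0 := by
    intro hcrit a s hmin
    obtain ⟨a', s', ha', hs'⟩ := not_not.1 hcrit
    have hmodel : ∀ᶠ t : ℝ in nhdsWithin 0 (Ioi 0), ∀ v ∈ WMinSet K (Fval f xb),
        modelFn (f (a' v)) xb (t • s') ∈ interior (-K) :=
      (Filter.eventually_all_finite hWfin).2 fun v hv =>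
        eventually_modelFn_smul_mem hnegcone _ _ _ (hint ▸ hs' v hv)
    have hnorm : ∀ᶠ t : ℝ in nhds 0, ‖t • s'‖ < Ω :=
      (by fun_prop : Continuous fun t : ℝ => ‖t • s'‖).continuousAt.eventually_lt
        continuousAt_const (by simpa using hΩ)
    obtain ⟨t, htm, htn, ht⟩ :=
      (hmodel.and ((hnorm.filter_mono nhdsWithin_le_nhds).and self_mem_nhdsWithin)).exists
    refine (hmin.2.2 a' (t • s') ha' htn.le).trans_lt ((theta_neg_iff hWne hK _ _).2 ?_)
    refine fun v hv => ⟨htm v hv, ?_⟩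
    rw [map_smul]
    exact smul_mem_interior_of_cone hnegcone ht (hint ▸ hs' v hv)
  refine ⟨⟨fun h => descent h a₀ s₀ hmin, fun h hcrit => hcrit ⟨a₀, s₀, hmin.1, ?_⟩⟩, ?_⟩
  · exact fun v hv => hint ▸ ((theta_neg_iff hWne hK _ _).1 h v hv).2
  · rintro hcrit a s hmin' rfl
    obtain ⟨v, hv⟩ := hWne
    have h := ((theta_neg_iff ⟨v, hv⟩ hK _ _).1 (descent hcrit a 0 hmin') v hv).2
    rw [hint] at h
    exact h0 (by simpa using h)
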